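/- Suppose {b_{i_1}, …, b_{i_{n*}}} ⊆ {b_1, …, b_{n_B}} is a subset such that any min(n*, u_1) of its elements are linearly independent over F, and fix v with 1 ≤ v ≤ n*. Then there exist D1, an orthogonal array OA(s^u, g(v), s, 2), and D2, a Latin hypercube LHD(s^u, v·s^{u−u_1}), such that (D1, D2) is a marginally coupled design and D2 is a non-cascading Latin hypercube. -/

import Mathlib

/-- `D` is an orthogonal array OA(n, m, s, t): in any `t` distinct columns,
every `t`-tuple of levels occurs in exactly `n / s^t` rows. -/
def IsOA (n m s t : ℕ) (D : Fin n → Fin m → Fin s) : Prop :=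
  ∀ cols : Fin t → Fin m, Function.Injective cols →
    ∀ lvl : Fin t → Fin s,
      {i : Fin n | ∀ r, D i (cols r) = lvl r}.ncard = n / s ^ t

/-- `D` is a Latin hypercube LHD(n, k): each column is a permutation of `{0, …, n-1}`. -/
def IsLHD (n k : ℕ) (D : Fin n → Fin k → Fin n) : Prop :=
  ∀ j, Function.Bijective fun i => D i j

/-- `(D1, D2)` is a marginally coupled design: for every column `c` of `D1`,
every level `ℓ`, and every column `j` of `D2`, the values `⌊D2 i j / s⌋` over
the rows `i` with `D1 i c = ℓ` are pairwise distinct. -/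
def IsMCD (n m k s : ℕ) (D1 : Fin n → Fin m → Fin s) (D2 : Fin n → Fin k → Fin n) : Prop :=
  ∀ (c : Fin m) (ℓ : Fin s) (j : Fin k) (i i' : Fin n),
    D1 i c = ℓ → D1 i' c = ℓ → (D2 i j : ℕ) / s = (D2 i' j : ℕ) / s → i = i'

/-- `D2` is non-cascading: no two distinct columns of the array with entries
`⌊D2 i j / s⌋` can be obtained from each other by a permutation of the levels
`{0, …, n/s - 1}`. -/
def NonCascading (n k s : ℕ) (D2 : Fin n → Fin k → Fin n) : Prop :=
  ∀ j j' : Fin k, j ≠ j' →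
    ¬ ∃ π : ℕ → ℕ, Set.BijOn π (Set.Iio (n / s)) (Set.Iio (n / s)) ∧
      ∀ i, (D2 i j : ℕ) / s = π ((D2 i j' : ℕ) / s)

/-- The count `f(v)` of the paper: `f(v) = (s-1)^v s^(u₁-v)` for `1 ≤ v ≤ u₁`, and
`f(v) = s^{u₁} Σ_{i=0}^{u₁} (-1)^i C(v,i) s^{-i} + Σ_{i=u₁+1}^v (-1)^i C(v,i)`
for `v > u₁` (written with integer arithmetic). -/
def fCount (s u₁ v : ℕ) : ℤ :=
  if v ≤ u₁ then ((s : ℤ) - 1) ^ v * (s : ℤ) ^ (u₁ - v)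
  else (∑ i ∈ Finset.range (u₁ + 1), (-1) ^ i * (v.choose i : ℤ) * (s : ℤ) ^ (u₁ - i))
    + ∑ i ∈ Finset.Icc (u₁ + 1) v, (-1) ^ i * (v.choose i : ℤ)

section LinearCounting

open Finset

variable {F : Type*} [Field F]

/-- The matrix with linearly independent rows `c i` defines a surjective linear map. -/
theorem mulVecLin_surjective_of_linearIndependent {m n : Type*} [Fintype m] [Fintype n]
    {c : Matrix m n F} (hc : LinearIndependent F c) : Function.Surjective c.mulVecLin := by
  rw [← LinearMap.range_eq_top]
  apply Submodule.eq_top_of_finrank_eq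
  rw [Module.finrank_fintype_fun_eq_card]
  exact hc.rank_matrix

variable [Fintype F] [DecidableEq F]

/-- A system of linearly independent linear equations over a finite field has
`|F| ^ (unknowns - equations)` solutions. -/
theorem card_dotProduct_eq_mul_pow {m n : Type*} [Fintype m] [Fintype n] [DecidableEq n]
    {c : m → n → F} (hc : LinearIndependent F c) (a : m → F) :
    #{x : n → F | ∀ i, c i ⬝ᵥ x = a i} * Fintype.card F ^ Fintype.card m =
      Fintype.card F ^ Fintype.card n := by
  classical
  have hsurj := mulVecLin_surjective_of_linearIndependent (c := c) hc
  have hfib : ∀ y : m → F, #{x : n → F | Matrix.mulVecLin c x = y} =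
      #{x : n → F | ∀ i, c i ⬝ᵥ x = a i} := by
    intro y
    rw [AddMonoidHom.card_fiber_eq_of_mem_range (Matrix.mulVecLin c) (hsurj y) (hsurj a)]
    congr 1
    ext x
    simp only [mem_filter, mem_univ, true_and, funext_iff]
    rfl
  have h := card_eq_sum_card_fiberwise (s := (univ : Finset (n → F)))
    (t := (univ : Finset (m → F))) (f := Matrix.mulVecLin c) (fun _ _ => by simp)
  simp only [hfib] at h
  simp only [sum_const, card_univ, Fintype.card_fun, smul_eq_mul] at h
  rw [h, mul_comm]

/-- The number of common zeros of a subfamily `T` of linear forms in `k` unknowns, any `k` of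
which are linearly independent. -/
theorem card_forall_dotProduct_eq_zero {k v : ℕ} (c : Fin v → Fin k → F)
    (hc : ∀ T : Finset (Fin v), #T ≤ k → LinearIndependent F fun t : T => c t)
    (T : Finset (Fin v)) :
    #{x : Fin k → F | ∀ i ∈ T, c i ⬝ᵥ x = 0} = Fintype.card F ^ (k - #T) := by
  have small : ∀ T : Finset (Fin v), #T ≤ k →
      #{x : Fin k → F | ∀ i ∈ T, c i ⬝ᵥ x = 0} = Fintype.card F ^ (k - #T) := by
    intro T hT
    have h := card_dotProduct_eq_mul_pow (hc T hT) 0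
    simp only [Pi.zero_apply, Subtype.forall, Fintype.card_coe, Fintype.card_fin] at h
    refine Nat.eq_of_mul_eq_mul_right (pow_pos (Fintype.card_pos (α := F)) #T) ?_
    rw [h, ← pow_add, Nat.sub_add_cancel hT]
  rcases le_total #T k with hT | hT
  · exact small T hT
  · obtain ⟨T', hT', hcard⟩ := exists_subset_card_eq hT
    have h := small T' hcard.le
    rw [hcard, Nat.sub_self, pow_zero] at h
    rw [Nat.sub_eq_zero_of_le hT, pow_zero]
    refine le_antisymm (h ▸ card_le_card ?_) (card_pos.2 ⟨0, by simp⟩)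
    intro x hx
    simp only [mem_filter, mem_univ, true_and] at hx ⊢
    exact fun i hi => hx i (hT' hi)

/-- The number of common non-zeros of a family of linear forms in `k` unknowns, any `k` of
which are linearly independent. -/
theorem card_forall_dotProduct_ne_zero {k v : ℕ} (c : Fin v → Fin k → F)
    (hc : ∀ T : Finset (Fin v), #T ≤ k → LinearIndependent F fun t : T => c t) :
    (#{x : Fin k → F | ∀ i, c i ⬝ᵥ x ≠ 0} : ℤ) =
      ∑ j ∈ range (v + 1), (-1) ^ j * (v.choose j : ℤ) * (Fintype.card F : ℤ) ^ (k - j) := by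
  have h := inclusion_exclusion_card_inf_compl (univ : Finset (Fin v))
    (fun i => ({x : Fin k → F | c i ⬝ᵥ x = 0} : Finset (Fin k → F)))
  have hinf : ∀ T : Finset (Fin v),
      (T.inf fun i => ({x : Fin k → F | c i ⬝ᵥ x = 0} : Finset (Fin k → F))) =
        ({x : Fin k → F | ∀ i ∈ T, c i ⬝ᵥ x = 0} : Finset (Fin k → F)) := by
    intro T
    ext x
    simp [mem_inf]
  have hcompl : ((univ : Finset (Fin v)).inf fun i =>
      ({x : Fin k → F | c i ⬝ᵥ x = 0} : Finset (Fin k → F))ᶜ) =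
        ({x : Fin k → F | ∀ i, c i ⬝ᵥ x ≠ 0} : Finset (Fin k → F)) := by
    ext x
    simp [mem_inf]
  rw [hcompl] at h
  simp only [hinf, card_forall_dotProduct_eq_zero c hc, Nat.cast_pow] at h
  rw [h, sum_powerset_apply_card (fun j => (-1 : ℤ) ^ j * (Fintype.card F : ℤ) ^ (k - j))]
  simp only [card_univ, Fintype.card_fin, nsmul_eq_mul]
  exact sum_congr rfl fun j _ => by ring

/-- Normalizing at a linear form `c i₀`, the common non-zeros of a family of linear forms fall
into classes of `|F| - 1` proportional vectors. -/
theorem card_forall_dotProduct_ne_zero_eq_mul {n : Type*} {v : ℕ} [Fintype n]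
    [DecidableEq n] (c : Fin v → n → F) (i₀ : Fin v) :
    #{x : n → F | ∀ i, c i ⬝ᵥ x ≠ 0} =
      #{x : n → F | c i₀ ⬝ᵥ x = 1 ∧ ∀ i, c i ⬝ᵥ x ≠ 0} * (Fintype.card F - 1) := by
  have hunits : #{a : F | a ≠ 0} = Fintype.card F - 1 := by
    rw [filter_ne' univ (0 : F), card_erase_of_mem (mem_univ _), card_univ]
  rw [← hunits, ← card_product]
  refine card_nbij' (fun x => ((c i₀ ⬝ᵥ x)⁻¹ • x, c i₀ ⬝ᵥ x)) (fun p => p.2 • p.1) ?_ ?_ ?_ ?_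
  · intro x hx
    simp only [coe_filter, mem_univ, true_and, Set.mem_ofPred_eq] at hx
    simp [hx]
  · rintro ⟨x, a⟩ hx
    simp only [coe_product, coe_filter, mem_univ, true_and, Set.mem_prod,
      Set.mem_ofPred_eq] at hx
    simp [hx]
  · intro x hx
    simp only [coe_filter, mem_univ, true_and, Set.mem_ofPred_eq] at hx
    simp [smul_smul, hx i₀]
  · rintro ⟨x, a⟩ hx
    simp only [coe_product, coe_filter, mem_univ, true_and, Set.mem_prod,
      Set.mem_ofPred_eq] at hx
    simp [hx, smul_smul]

end LinearCounting

/-- `fCount` as a single alternating sum, with truncated exponents. -/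
theorem fCount_eq_sum (s k v : ℕ) :
    fCount s k v =
      ∑ j ∈ Finset.range (v + 1), (-1) ^ j * (v.choose j : ℤ) * (s : ℤ) ^ (k - j) := by
  unfold fCount
  split_ifs with h
  · rw [sub_eq_neg_add, add_pow, Finset.sum_mul]
    refine Finset.sum_congr rfl fun j hj => ?_
    have hj' : j ≤ v := Nat.lt_succ_iff.1 (Finset.mem_range.1 hj)
    rw [show k - j = (v - j) + (k - v) by omega, pow_add]
    ring
  · rw [← Finset.sum_range_add_sum_Ico _ (show k + 1 ≤ v + 1 by omega)]
    congr 1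
    refine Finset.sum_congr (by ext; simp) fun j hj => ?_
    rw [Nat.sub_eq_zero_of_le (by simp at hj; omega), pow_zero, mul_one]

/-- Distinct vectors on which some linear form takes the value `1` form linearly independent
pairs. -/
theorem linearIndependent_of_dotProduct_eq_one {F n : Type*} [Field F] [Fintype n]
    {z : Fin 2 → n → F} (w : n → F) (hw : ∀ r, z r ⬝ᵥ w = 1) (hz : z 0 ≠ z 1) :
    LinearIndependent F z := by
  refine linearIndependent_fin2.2 ⟨fun h => ?_, fun a h => hz ?_⟩
  · simpa [h] using hw 1
  · have ha := congrArg (· ⬝ᵥ w) h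
    simp only [smul_dotProduct, hw, smul_eq_mul, mul_one] at ha
    rw [← h, ha, one_smul]

/-- A bijection of `F ^ u` with `{0, …, |F| ^ u - 1}` whose level sets under division by `|F|`
are the lines in direction `w`. -/
theorem exists_equiv_div_card_eq_iff {F : Type*} [Field F] [Fintype F] {u : ℕ} (i₀ : Fin u)
    (hi₀ : (i₀ : ℕ) = 0) (w : Fin u → F) (hw : w i₀ = 1) :
    ∃ φ : (Fin u → F) ≃ Fin (Fintype.card F ^ u), ∀ x y,
      (φ x : ℕ) / Fintype.card F = (φ y : ℕ) / Fintype.card F ↔ ∃ a : F, x - y = a • w := by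
  cases u with
  | zero => exact i₀.elim0
  | succ k =>
    obtain rfl : i₀ = 0 := Fin.ext hi₀
    let ψ : (Fin (k + 1) → F) ≃ (Fin k → F) × F :=
      { toFun := fun x => (fun i => x i.succ - x 0 * w i.succ, x 0)
        invFun := fun p => Fin.cons p.2 fun i => p.1 i + p.2 * w i.succ
        left_inv := fun x => by
          ext i
          refine Fin.cases ?_ (fun i => ?_) i <;> simp
        right_inv := fun p => by ext <;> simp }
    let eY : (Fin k → F) ≃ Fin (Fintype.card F ^ k) := Fintype.equivFinOfCardEq (by simp)
    refine ⟨ψ.trans ((eY.prodCongr (Fintype.equivFin F)).trans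
      (finProdFinEquiv.trans (finCongr (pow_succ _ _).symm))), fun x y => ?_⟩
    have hpos : 0 < Fintype.card F := Fintype.card_pos
    simp only [Equiv.trans_apply, Equiv.prodCongr_apply, Prod.map, finProdFinEquiv_apply_val,
      finCongr_apply, Fin.val_cast, Nat.add_mul_div_left _ _ hpos,
      Nat.div_eq_of_lt (Fin.is_lt _), zero_add, Fin.val_inj, eY.apply_eq_iff_eq]
    simp only [ψ, Equiv.coe_fn_mk, funext_iff]
    constructor
    · intro h
      refine ⟨x 0 - y 0, fun i => ?_⟩
      refine Fin.cases ?_ (fun i => ?_) i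
      · simp [hw]
      · simp only [Pi.sub_apply, Pi.smul_apply, smul_eq_mul]
        linear_combination h i
    · rintro ⟨a, h⟩ i
      have h0 := h 0
      have hi := h i.succ
      simp only [Pi.sub_apply, Pi.smul_apply, smul_eq_mul, hw, mul_one] at h0 hi
      linear_combination hi - w i.succ * h0

/-- Vectors `z c` with `z c ⬝ᵥ w j ≠ 0` for all `j`, pairwise linearly independent, and vectors
`w j` with first entry `1`, pairwise distinct, yield a marginally coupled design with a
non-cascading Latin hypercube. -/
theorem exists_isMCD_of_dotProduct_ne_zero {F : Type*} [Field F] [Fintype F] {u m k : ℕ}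
    (i₀ : Fin u) (hi₀ : (i₀ : ℕ) = 0) (z : Fin m → Fin u → F) (w : Fin k → Fin u → F)
    (hz : ∀ cols : Fin 2 → Fin m, Function.Injective cols → LinearIndependent F (z ∘ cols))
    (hw : ∀ j, w j i₀ = 1) (hw_inj : Function.Injective w) (hzw : ∀ c j, z c ⬝ᵥ w j ≠ 0) :
    ∃ (D1 : Fin (Fintype.card F ^ u) → Fin m → Fin (Fintype.card F))
      (D2 : Fin (Fintype.card F ^ u) → Fin k → Fin (Fintype.card F ^ u)),
      IsOA (Fintype.card F ^ u) m (Fintype.card F) 2 D1 ∧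
      IsLHD (Fintype.card F ^ u) k D2 ∧
      IsMCD (Fintype.card F ^ u) m k (Fintype.card F) D1 D2 ∧
      NonCascading (Fintype.card F ^ u) k (Fintype.card F) D2 := by
  classical
  let e : Fin (Fintype.card F ^ u) ≃ (Fin u → F) :=
    (Fintype.equivFinOfCardEq (by simp)).symm
  let l : F ≃ Fin (Fintype.card F) := Fintype.equivFin F
  choose φ hφ using fun j => exists_equiv_div_card_eq_iff i₀ hi₀ (w j) (hw j)
  refine ⟨fun i c => l (z c ⬝ᵥ e i), fun i j => φ j (e i), ?_, ?_, ?_, ?_⟩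
  · intro cols hcols lvl
    have h := card_dotProduct_eq_mul_pow (hz cols hcols) (fun r => l.symm (lvl r))
    have hset : {i | ∀ r, l (z (cols r) ⬝ᵥ e i) = lvl r} =
        e ⁻¹' ↑({x : Fin u → F | ∀ r, (z ∘ cols) r ⬝ᵥ x = l.symm (lvl r)} :
          Finset (Fin u → F)) := by
      ext i
      simp [Equiv.eq_symm_apply]
    rw [hset, ← e.image_symm_eq_preimage, Set.ncard_image_of_injective _ e.symm.injective,
      Set.ncard_coe_finset]
    simp only [Fintype.card_fin] at h
    rw [← h, Nat.mul_div_cancel _ (pow_pos Fintype.card_pos 2)]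
    congr!
  · exact fun j => (φ j).bijective.comp e.bijective
  · intro c ℓ j i i' hi hi' hdiv
    obtain ⟨a, ha⟩ := (hφ j _ _).1 hdiv
    have h : z c ⬝ᵥ (e i - e i') = 0 := by
      rw [dotProduct_sub, l.injective (hi.trans hi'.symm), sub_self]
    rw [ha, dotProduct_smul, smul_eq_mul] at h
    obtain rfl := (mul_eq_zero.1 h).resolve_right (hzw c j)
    rw [zero_smul, sub_eq_zero] at ha
    exact e.injective ha
  · rintro j j' hj ⟨π, -, hπ⟩
    have h' := (hφ j' (w j') 0).2 ⟨1, by simp⟩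
    have h1 := hπ (e.symm (w j'))
    have h2 := hπ (e.symm 0)
    simp only [Equiv.apply_symm_apply] at h1 h2
    obtain ⟨a, ha⟩ := (hφ j (w j') 0).1 (by rw [h1, h2, h'])
    rw [sub_zero] at ha
    have h0 := congrFun ha i₀
    simp only [Pi.smul_apply, hw, smul_eq_mul, mul_one] at h0
    rw [← h0, one_smul] at ha
    exact hj (hw_inj ha.symm)

/-- Linear independence of the members of all subfamilies of size `min m k` passes to all
subfamilies of size at most `k`. -/
theorem linearIndependent_of_card_le {F V : Type*} [Field F] [AddCommGroup V] [Module F V]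
    {m k : ℕ} {c : Fin m → V}
    (hc : ∀ T : Finset (Fin m), T.card = min m k → LinearIndependent F fun t : T => c t)
    (T : Finset (Fin m)) (hT : T.card ≤ k) : LinearIndependent F fun t : T => c t := by
  obtain ⟨T', hTT', -, hT'⟩ := Finset.exists_subsuperset_card_eq (Finset.subset_univ T)
    (le_min (T.card_le_univ.trans_eq (by simp)) hT) (show min m k ≤ _ by simp)
  exact (hc T' hT').comp (fun t : T => (⟨t, hTT' t.2⟩ : T'))
    fun a b h => Subtype.ext (congrArg (fun t : T' => (t : Fin m)) h)

/-- if `{b_{i₁}, …, b_{i_{n*}}}` is a subset of the `b`-vectors such that any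
`min(n*, u₁)` of its elements are linearly independent, and `1 ≤ v ≤ n*`, then with
`g(v) = f(v)/(s-1)` there exists a marginally coupled design `(D1, D2)` with `D1` an
OA(s^u, g(v), s, 2) and `D2` a non-cascading LHD(s^u, v·s^(u-u₁)). -/
theorem stmt8 {F : Type*} [Field F] [Fintype F]
    (u u₁ nstar : ℕ) (hu₁ : 1 ≤ u₁) (hu : u₁ ≤ u)
    (b : Fin ((Fintype.card F - 1) ^ (u₁ - 1)) → Fin u → F)
    (hb_inj : Function.Injective b)
    (hb_enum : ∀ x : Fin u → F,
      (x ⟨0, by omega⟩ = 1 ∧ (∀ i : Fin u, 1 ≤ (i : ℕ) → (i : ℕ) < u₁ → x i ≠ 0) ∧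
        (∀ i : Fin u, u₁ ≤ (i : ℕ) → x i = 0)) ↔ ∃ t, b t = x)
    (ι : Fin nstar → Fin ((Fintype.card F - 1) ^ (u₁ - 1)))
    (hι : Function.Injective ι)
    (hindep : ∀ T : Finset (Fin nstar), T.card = min nstar u₁ →
      LinearIndependent F (fun t : T => b (ι t.1)))
    (v : ℕ) (hv1 : 1 ≤ v) (hv2 : v ≤ nstar)
    (gv : ℕ) (hgv : (gv : ℤ) * ((Fintype.card F : ℤ) - 1) = fCount (Fintype.card F) u₁ v) :
    ∃ (D1 : Fin (Fintype.card F ^ u) → Fin gv → Fin (Fintype.card F))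
      (D2 : Fin (Fintype.card F ^ u) → Fin (v * Fintype.card F ^ (u - u₁)) →
        Fin (Fintype.card F ^ u)),
      IsOA (Fintype.card F ^ u) gv (Fintype.card F) 2 D1 ∧
      IsLHD (Fintype.card F ^ u) (v * Fintype.card F ^ (u - u₁)) D2 ∧
      IsMCD (Fintype.card F ^ u) gv (v * Fintype.card F ^ (u - u₁)) (Fintype.card F) D1 D2 ∧
      NonCascading (Fintype.card F ^ u) (v * Fintype.card F ^ (u - u₁)) (Fintype.card F) D2 := by
  classical
  obtain ⟨d, rfl⟩ := Nat.exists_eq_add_of_le hu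
  let i₀ : Fin (u₁ + d) := ⟨0, by omega⟩
  let B : Fin v → Fin (u₁ + d) → F := fun i => b (ι (Fin.castLE hv2 i))
  let c : Fin v → Fin u₁ → F := fun i r => B i (Fin.castAdd d r)
  have hB : ∀ i, Fin.append (c i) 0 = B i := by
    intro i
    ext r
    refine Fin.addCases (fun r => ?_) (fun r => ?_) r
    · simp [c]
    · rw [Fin.append_right, ((hb_enum (B i)).2 ⟨_, rfl⟩).2.2 _ (by simp)]
      rfl
  have hB_inj : Function.Injective B :=
    hb_inj.comp (hι.comp (Fin.castLE_injective hv2))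
  have hc_inj : Function.Injective c := fun i j h => hB_inj (by rw [← hB, ← hB, h])
  have hindep' := linearIndependent_of_card_le (c := b ∘ ι) hindep
  have hc : ∀ T : Finset (Fin v), T.card ≤ u₁ → LinearIndependent F fun t : T => c t := by
    intro T hT
    let E : (Fin u₁ → F) →ₗ[F] (Fin (u₁ + d) → F) :=
      { toFun := fun x => Fin.append x 0
        map_add' := fun x y => by
          ext r
          refine Fin.addCases (fun r => ?_) (fun r => ?_) r <;> simp
        map_smul' := fun a x => by
          ext r
          refine Fin.addCases (fun r => ?_) (fun r => ?_) r <;> simp }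
    refine LinearIndependent.of_comp E ?_
    have hE : (E ∘ fun t : T => c t) = fun t : T => B t := funext fun t => hB t
    rw [hE]
    have h := hindep' (T.map (Fin.castLEEmb hv2)) (by simpa using hT)
    exact h.comp (fun t : T => ⟨Fin.castLEEmb hv2 t, Finset.mem_map_of_mem _ t.2⟩)
      fun a b h => Subtype.ext ((Fin.castLEEmb hv2).injective (congrArg Subtype.val h))
  let j₀ : Fin v := ⟨0, hv1⟩
  let S : Finset (Fin u₁ → F) := {x | c j₀ ⬝ᵥ x = 1 ∧ ∀ i, c i ⬝ᵥ x ≠ 0}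
  have hS : S.card = gv := by
    have h1 := card_forall_dotProduct_ne_zero c hc
    rw [← fCount_eq_sum, card_forall_dotProduct_ne_zero_eq_mul c j₀, ← hgv, Nat.cast_mul,
      Nat.cast_sub Fintype.card_pos, Nat.cast_one] at h1
    have hq1 : (1 : ℤ) < Fintype.card F := by exact_mod_cast Fintype.one_lt_card (α := F)
    exact_mod_cast mul_right_cancel₀ (by omega) h1
  have hdot : ∀ (x x' : Fin u₁ → F) (y y' : Fin d → F),
      Fin.append x y ⬝ᵥ Fin.append x' y' = x ⬝ᵥ x' + y ⬝ᵥ y' := by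
    intro x x' y y'
    simp [dotProduct, Fin.sum_univ_add]
  have happ : ∀ {x x' : Fin u₁ → F} {y y' : Fin d → F},
      Fin.append x y = Fin.append x' y' → x = x' ∧ y = y' := by
    intro x x' y y' h
    exact ⟨funext fun r => by simpa using congrFun h (Fin.castAdd d r),
      funext fun r => by simpa using congrFun h (Fin.natAdd u₁ r)⟩
  let eS : Fin gv ≃ S := (Finset.equivFinOfCardEq hS).symm
  let z : Fin gv → Fin (u₁ + d) → F := fun t => Fin.append (eS t).1 0
  have hmem : ∀ t, c j₀ ⬝ᵥ (eS t).1 = 1 ∧ ∀ i, c i ⬝ᵥ (eS t).1 ≠ 0 := fun t =>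
    (Finset.mem_filter.1 (eS t).2).2
  let eW : Fin (v * Fintype.card F ^ (u₁ + d - u₁)) ≃ Fin v × (Fin d → F) :=
    Fintype.equivOfCardEq (by simp)
  refine exists_isMCD_of_dotProduct_ne_zero i₀ rfl z
    (fun j => Fin.append (c (eW j).1) (eW j).2) ?_ ?_ ?_ ?_
  · intro cols hcols
    refine linearIndependent_of_dotProduct_eq_one (Fin.append (c j₀) 0) (fun r => ?_) ?_
    · simp [z, hdot, dotProduct_comm _ (c j₀), hmem]
    · intro h
      have h' := (happ h).1
      exact absurd (hcols (eS.injective (Subtype.ext h'))) (by simp)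
  · intro j
    change Fin.append _ _ (Fin.castAdd d ⟨0, hu₁⟩) = 1
    rw [Fin.append_left]
    exact ((hb_enum (B (eW j).1)).2 ⟨_, rfl⟩).1
  · intro j j' h
    obtain ⟨h1, h2⟩ : c (eW j).1 = c (eW j').1 ∧ (eW j).2 = (eW j').2 :=
      happ h
    exact eW.injective (Prod.ext (hc_inj h1) h2)
  · intro t j
    simp only [z, hdot, zero_dotProduct, add_zero]
    rw [dotProduct_comm]
    exact (hmem t).2 _
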